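/- arXiv:1202.2235 — 2 statements merged into one kernel-verified Lean document; each statement's English description precedes it below -/
import Mathlib

section
/- Let Ω ⊆ ℝ² be open, V, W : Ω → ℝ² be C^∞ vector fields that are linearly independent at every point of Ω, and μ : Ω → ℝ be C^∞ with [V,W] = μ·V on Ω. Define μ_1 = μ and μ_{j+1} = μ_j·μ + ∂_W μ_j for j ≥ 1, where ∂_W f(z) = Df(z)(W(z)). Let φ_V : ℝ × Ω → Ω be a C^∞ flow of V, let z : ℝ → Ω satisfy z'(s) = W(z(s)), and let T : ℝ → ℝ be C^∞ with T(s) > 0 and φ_V(T(s), z(s)) = z(s) for all s. Then for every n ≥ 1 and every s, the n-th derivative of T at s equals ∫₀^{T(s)} μ_n(φ_V(t, z(s))) dt. -/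
section Flow

open Set Function intervalIntegral

variable {E : Type*} [NormedAddCommGroup E] [NormedSpace ℝ E]

/-- A solution of a linear differential equation that vanishes at time `0` vanishes identically. -/
theorem eq_zero_of_hasDerivAt_clm_apply {A : ℝ → E →L[ℝ] E} (hA : Continuous A) {x : ℝ → E}
    (hx : ∀ t, HasDerivAt x (A t (x t)) t) (hx0 : x 0 = 0) (t : ℝ) : x t = 0 := by
  obtain ⟨C, hC⟩ := (isCompact_Icc (a := -|t| - 1) (b := |t| + 1)).exists_bound_of_continuousOn
    hA.continuousOn
  have ht := abs_nonneg t
  have hEq : EqOn x (fun _ => (0 : E)) (Icc (-|t| - 1) (|t| + 1)) := by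
    refine ODE_solution_unique_of_mem_Icc (v := fun t y => A t y) (s := fun _ => univ)
      (K := C.toNNReal) (t₀ := 0) (fun s hs => ?_) ⟨by linarith, by linarith⟩
      (fun s _ => (hx s).continuousAt.continuousWithinAt) (fun s _ => hx s) (fun _ _ => mem_univ _)
      continuousOn_const (fun s _ => by simpa using hasDerivAt_const s (0 : E))
      (fun _ _ => mem_univ _) hx0
    have hle : ‖A s‖₊ ≤ C.toNNReal := by
      rw [← NNReal.coe_le_coe, coe_nnnorm]
      exact (hC s (Ioo_subset_Icc_self hs)).trans (Real.le_coe_toNNReal C)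
    exact ((A s).lipschitz.weaken hle).lipschitzOnWith
  exact hEq ⟨by linarith [neg_abs_le t], by linarith [le_abs_self t]⟩

variable {Ω : Set E} {V W : E → E} {μ f : E → ℝ} {φ : ℝ → E → E} {z : E}

theorem contDiffAt_uncurry_flow {n : WithTop ℕ∞} (hΩ : IsOpen Ω)
    (hφ : ContDiffOn ℝ n (uncurry φ) (univ ×ˢ Ω)) (hz : z ∈ Ω) (t : ℝ) :
    ContDiffAt ℝ n (uncurry φ) (t, z) :=
  hφ.contDiffAt ((isOpen_univ.prod hΩ).mem_nhds ⟨mem_univ t, hz⟩)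

theorem fderiv_uncurry_flow_time (hΩ : IsOpen Ω) (hφ : ContDiffOn ℝ 2 (uncurry φ) (univ ×ˢ Ω))
    (hode : ∀ t, ∀ z ∈ Ω, HasDerivAt (fun τ => φ τ z) (V (φ t z)) t) (hz : z ∈ Ω) (t : ℝ) :
    fderiv ℝ (uncurry φ) (t, z) (1, 0) = V (φ t z) := by
  have h := ((contDiffAt_uncurry_flow hΩ hφ hz t).differentiableAt two_ne_zero).hasFDerivAt
  have h' := h.comp_hasDerivAt t ((hasDerivAt_id t).prodMk (hasDerivAt_const t z))
  exact h'.unique (hode t z hz)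

/-- The variational equation: the space derivative of the flow of `V` solves the linearization
of `V` along the orbit. -/
theorem hasDerivAt_fderiv_flow (hΩ : IsOpen Ω) (hV : ContDiffOn ℝ 1 V Ω)
    (hφ : ContDiffOn ℝ 2 (uncurry φ) (univ ×ˢ Ω)) (hmem : ∀ t, ∀ z ∈ Ω, φ t z ∈ Ω)
    (hode : ∀ t, ∀ z ∈ Ω, HasDerivAt (fun τ => φ τ z) (V (φ t z)) t) (hz : z ∈ Ω) (v : E) (t : ℝ) :
    HasDerivAt (fun t => fderiv ℝ (uncurry φ) (t, z) (0, v))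
      (fderiv ℝ V (φ t z) (fderiv ℝ (uncurry φ) (t, z) (0, v))) t := by
  have hF := contDiffAt_uncurry_flow hΩ hφ hz t
  have hF1 : HasFDerivAt (uncurry φ) (fderiv ℝ (uncurry φ) (t, z)) (t, z) :=
    (hF.differentiableAt two_ne_zero).hasFDerivAt
  have hF2 : HasFDerivAt (fderiv ℝ (uncurry φ)) (fderiv ℝ (fderiv ℝ (uncurry φ)) (t, z)) (t, z) :=
    ((hF.fderiv_right (m := 1) (by norm_num)).differentiableAt one_ne_zero).hasFDerivAt
  have hVd : HasFDerivAt V (fderiv ℝ V (uncurry φ (t, z))) (uncurry φ (t, z)) :=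
    ((hV.contDiffAt (hΩ.mem_nhds (hmem t z hz))).differentiableAt one_ne_zero).hasFDerivAt
  have hev : (fun p => fderiv ℝ (uncurry φ) p (1, 0)) =ᶠ[nhds (t, z)] V ∘ uncurry φ := by
    filter_upwards [(isOpen_univ.prod hΩ).mem_nhds ⟨mem_univ t, hz⟩] with p hp
    exact fderiv_uncurry_flow_time hΩ hφ hode hp.2 p.1
  have hmixed : fderiv ℝ (fderiv ℝ (uncurry φ)) (t, z) (0, v) (1, 0) =
      fderiv ℝ V (φ t z) (fderiv ℝ (uncurry φ) (t, z) (0, v)) := by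
    have h := (hF2.clm_apply (hasFDerivAt_const ((1 : ℝ), (0 : E)) (t, z))).unique
      ((hVd.comp (t, z) hF1).congr_of_eventuallyEq hev)
    simpa using DFunLike.congr_fun h (0, v)
  have hsymm := hF.isSymmSndFDerivAt (by simp) (1, 0) (0, v)
  have h : HasDerivAt (fun t => fderiv ℝ (uncurry φ) (t, z))
      (fderiv ℝ (fderiv ℝ (uncurry φ)) (t, z) (1, 0)) t :=
    hF2.comp_hasDerivAt t ((hasDerivAt_id t).prodMk (hasDerivAt_const t z))
  rw [← hmixed, ← hsymm]
  simpa using h.clm_apply (hasDerivAt_const t ((0 : ℝ), v))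

theorem continuous_comp_flow {F : Type*} [TopologicalSpace F] {g : E → F} (hg : ContinuousOn g Ω)
    (hmem : ∀ t, ∀ z ∈ Ω, φ t z ∈ Ω)
    (hode : ∀ t, ∀ z ∈ Ω, HasDerivAt (fun τ => φ τ z) (V (φ t z)) t) (hz : z ∈ Ω) :
    Continuous fun t => g (φ t z) :=
  hg.comp_continuous (continuous_iff_continuousAt.2 fun t => (hode t z hz).continuousAt)
    fun t => hmem t z hz

/-- If `[V, W] = μ • V`, the flow of `V` transports `W` to `W` minus a multiple of `V`, the
multiple being the integral of `μ` along the orbit. -/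
theorem fderiv_flow_apply_eq_sub (hΩ : IsOpen Ω) (hV : ContDiffOn ℝ 1 V Ω)
    (hW : ContDiffOn ℝ 1 W Ω) (hμ : ContinuousOn μ Ω)
    (hbracket : ∀ z ∈ Ω, fderiv ℝ W z (V z) - fderiv ℝ V z (W z) = μ z • V z)
    (hφ : ContDiffOn ℝ 2 (uncurry φ) (univ ×ˢ Ω)) (hmem : ∀ t, ∀ z ∈ Ω, φ t z ∈ Ω)
    (h0 : ∀ z ∈ Ω, φ 0 z = z)
    (hode : ∀ t, ∀ z ∈ Ω, HasDerivAt (fun τ => φ τ z) (V (φ t z)) t) (hz : z ∈ Ω) (t : ℝ) :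
    fderiv ℝ (uncurry φ) (t, z) (0, W z) =
      W (φ t z) - (∫ τ in (0 : ℝ)..t, μ (φ τ z)) • V (φ t z) := by
  have hd : ∀ {X : E → E}, ContDiffOn ℝ 1 X Ω → ∀ t,
      HasDerivAt (fun τ => X (φ τ z)) (fderiv ℝ X (φ t z) (V (φ t z))) t := fun hX t =>
    (((hX.contDiffAt (hΩ.mem_nhds (hmem t z hz))).differentiableAt
      one_ne_zero).hasFDerivAt).comp_hasDerivAt t (hode t z hz)
  have ha : ∀ t, HasDerivAt (fun t => ∫ τ in (0 : ℝ)..t, μ (φ τ z)) (μ (φ t z)) t := fun t =>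
    ((continuous_comp_flow hμ hmem hode hz).integral_hasStrictDerivAt 0 t).hasDerivAt
  have hinit : fderiv ℝ (uncurry φ) (0, z) (0, W z) = W z := by
    have h := ((contDiffAt_uncurry_flow hΩ hφ hz 0).differentiableAt two_ne_zero).hasFDerivAt
    have h' := h.comp z ((hasFDerivAt_const (0 : ℝ) z).prodMk (hasFDerivAt_id z))
    have hid : uncurry φ ∘ (fun y => (0, id y)) =ᶠ[nhds z] id := by
      filter_upwards [hΩ.mem_nhds hz] with y hy using h0 y hy
    simpa using DFunLike.congr_fun
      (h'.unique ((hasFDerivAt_id z).congr_of_eventuallyEq hid)) (W z)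
  have hzero := eq_zero_of_hasDerivAt_clm_apply
    (continuous_comp_flow (hV.continuousOn_fderiv_of_isOpen hΩ le_rfl) hmem hode hz)
    (x := fun t => fderiv ℝ (uncurry φ) (t, z) (0, W z) -
      (W (φ t z) - (∫ τ in (0 : ℝ)..t, μ (φ τ z)) • V (φ t z)))
    (fun t => by
      refine ((hasDerivAt_fderiv_flow hΩ hV hφ hmem hode hz (W z) t).sub
        ((hd hW t).sub ((ha t).smul (hd hV t)))).congr_deriv ?_
      rw [sub_eq_iff_eq_add.1 (hbracket _ (hmem t z hz))]
      simp only [map_sub, map_smul]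
      abel)
    (by simp [hinit, h0 z hz]) t
  exact sub_eq_zero.1 hzero

/-- Differentiation under the integral sign over a compact interval. -/
theorem hasDerivAt_intervalIntegral_of_continuous {g g' : ℝ → ℝ → ℝ} {a b : ℝ}
    (hg : ∀ s, Continuous (g s)) (hg' : Continuous (uncurry g'))
    (hderiv : ∀ s u, HasDerivAt (fun s => g s u) (g' s u) s) (s : ℝ) :
    HasDerivAt (fun s => ∫ u in a..b, g s u) (∫ u in a..b, g' s u) s := by
  obtain ⟨C, hC⟩ := ((isCompact_Icc (a := s - 1) (b := s + 1)).prod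
    (isCompact_uIcc (a := a) (b := b))).exists_bound_of_continuousOn hg'.continuousOn
  refine (hasDerivAt_integral_of_dominated_loc_of_deriv_le (bound := fun _ => C)
    (Icc_mem_nhds (sub_one_lt s) (lt_add_one s))
    (.of_forall fun r => (hg r).aestronglyMeasurable) ((hg s).intervalIntegrable a b)
    (hg'.comp (Continuous.prodMk_right s)).aestronglyMeasurable
    (.of_forall fun u hu r hr => hC (r, u) ⟨hr, uIoc_subset_uIcc hu⟩)
    intervalIntegrable_const (.of_forall fun u _ r _ => hderiv r u)).2

section Curve

variable {T τ : ℝ → ℝ} {c : ℝ → E} {s τ' : ℝ}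

/-- The derivative of the flow of `V` with varying time along an integral curve of `W`. -/
theorem hasDerivAt_flow_along_curve (hΩ : IsOpen Ω) (hV : ContDiffOn ℝ 1 V Ω)
    (hW : ContDiffOn ℝ 1 W Ω) (hμ : ContinuousOn μ Ω)
    (hbracket : ∀ z ∈ Ω, fderiv ℝ W z (V z) - fderiv ℝ V z (W z) = μ z • V z)
    (hφ : ContDiffOn ℝ 2 (uncurry φ) (univ ×ˢ Ω)) (hmem : ∀ t, ∀ z ∈ Ω, φ t z ∈ Ω)
    (h0 : ∀ z ∈ Ω, φ 0 z = z)
    (hode : ∀ t, ∀ z ∈ Ω, HasDerivAt (fun τ => φ τ z) (V (φ t z)) t)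
    (hc : c s ∈ Ω) (hcode : HasDerivAt c (W (c s)) s) (hτ : HasDerivAt τ τ' s) :
    HasDerivAt (fun s => φ (τ s) (c s))
      (W (φ (τ s) (c s)) + (τ' - ∫ t in (0 : ℝ)..τ s, μ (φ t (c s))) • V (φ (τ s) (c s))) s := by
  have h := ((contDiffAt_uncurry_flow hΩ hφ hc (τ s)).differentiableAt two_ne_zero).hasFDerivAt
  refine (h.comp_hasDerivAt s (hτ.prodMk hcode)).congr_deriv ?_
  have hsplit : ((τ', W (c s)) : ℝ × E) = τ' • (1, 0) + (0, W (c s)) := by simp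
  rw [hsplit, map_add, map_smul, fderiv_uncurry_flow_time hΩ hφ hode hc,
    fderiv_flow_apply_eq_sub hΩ hV hW hμ hbracket hφ hmem h0 hode hc, sub_smul]
  abel

/-- The derivative of a period function of `V` along an integral curve of `W`. -/
theorem hasDerivAt_period (hΩ : IsOpen Ω) (hV : ContDiffOn ℝ 1 V Ω)
    (hW : ContDiffOn ℝ 1 W Ω) (hμ : ContinuousOn μ Ω)
    (hbracket : ∀ z ∈ Ω, fderiv ℝ W z (V z) - fderiv ℝ V z (W z) = μ z • V z)
    (hφ : ContDiffOn ℝ 2 (uncurry φ) (univ ×ˢ Ω)) (hmem : ∀ t, ∀ z ∈ Ω, φ t z ∈ Ω)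
    (h0 : ∀ z ∈ Ω, φ 0 z = z)
    (hode : ∀ t, ∀ z ∈ Ω, HasDerivAt (fun τ => φ τ z) (V (φ t z)) t)
    (hc : c s ∈ Ω) (hcode : HasDerivAt c (W (c s)) s) (hne : V (c s) ≠ 0)
    (hT : DifferentiableAt ℝ T s) (hper : ∀ s, φ (T s) (c s) = c s) :
    HasDerivAt T (∫ t in (0 : ℝ)..T s, μ (φ t (c s))) s := by
  have h := hasDerivAt_flow_along_curve hΩ hV hW hμ hbracket hφ hmem h0 hode hc hcode hT.hasDerivAt
  simp only [hper] at h
  have hzero := add_eq_left.1 (h.unique hcode)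
  rw [← sub_eq_zero.1 ((smul_eq_zero.1 hzero).resolve_right hne)]
  exact hT.hasDerivAt

/-- The derivative, along an integral curve of `W`, of the integral of a function over the
periodic orbits of `V`. -/
theorem hasDerivAt_integral_orbit (hΩ : IsOpen Ω) (hV : ContDiffOn ℝ 1 V Ω)
    (hW : ContDiffOn ℝ 1 W Ω) (hμ : ContinuousOn μ Ω) (hf : ContDiffOn ℝ 1 f Ω)
    (hbracket : ∀ z ∈ Ω, fderiv ℝ W z (V z) - fderiv ℝ V z (W z) = μ z • V z)
    (hφ : ContDiffOn ℝ 2 (uncurry φ) (univ ×ˢ Ω)) (hmem : ∀ t, ∀ z ∈ Ω, φ t z ∈ Ω)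
    (h0 : ∀ z ∈ Ω, φ 0 z = z)
    (hode : ∀ t, ∀ z ∈ Ω, HasDerivAt (fun τ => φ τ z) (V (φ t z)) t)
    (hc : ∀ s, c s ∈ Ω) (hcode : ∀ s, HasDerivAt c (W (c s)) s) (hne : ∀ z ∈ Ω, V z ≠ 0)
    (hT : ContDiff ℝ 1 T) (hper : ∀ s, φ (T s) (c s) = c s) (s : ℝ) :
    HasDerivAt (fun s => ∫ t in (0 : ℝ)..T s, f (φ t (c s)))
      (∫ t in (0 : ℝ)..T s,
        (f (φ t (c s)) * μ (φ t (c s)) + fderiv ℝ f (φ t (c s)) (W (φ t (c s))))) s := by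
  have hTd : ∀ s, HasDerivAt T (deriv T s) s := fun s =>
    (hT.differentiable one_ne_zero s).hasDerivAt
  have hT'c : Continuous (deriv T) := hT.continuous_deriv le_rfl
  have hcc : Continuous c := continuous_iff_continuousAt.2 fun s => (hcode s).continuousAt
  have hf' := hf.continuousOn_fderiv_of_isOpen hΩ le_rfl
  have hfd : ∀ z ∈ Ω, HasFDerivAt f (fderiv ℝ f z) z := fun z hz =>
    ((hf.contDiffAt (hΩ.mem_nhds hz)).differentiableAt one_ne_zero).hasFDerivAt
  have hmem' : ∀ s t, φ t (c s) ∈ Ω := fun s t => hmem t _ (hc s)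
  have hflow : Continuous fun p : ℝ × ℝ => φ p.2 (c p.1) :=
    hφ.continuousOn.comp_continuous (continuous_snd.prodMk (hcc.comp continuous_fst))
      fun p => ⟨mem_univ _, hc p.1⟩
  have hscale : Continuous fun p : ℝ × ℝ => T p.1 * p.2 :=
    (hT.continuous.comp continuous_fst).mul continuous_snd
  have hflow' : Continuous fun p : ℝ × ℝ => φ (T p.1 * p.2) (c p.1) :=
    hflow.comp (continuous_fst.prodMk hscale)
  have ha : Continuous fun p : ℝ × ℝ => ∫ t in (0 : ℝ)..(T p.1 * p.2), μ (φ t (c p.1)) :=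
    continuous_parametric_intervalIntegral_of_continuous (f := fun p t => μ (φ t (c p.1)))
      (hμ.comp_continuous (hflow.comp ((continuous_fst.comp continuous_fst).prodMk continuous_snd))
        fun p => hmem' _ _) hscale
  set w : ℝ → ℝ → E := fun s u => W (φ (T s * u) (c s)) +
    (deriv T s * u - ∫ t in (0 : ℝ)..(T s * u), μ (φ t (c s))) • V (φ (T s * u) (c s)) with hw
  have hwc : Continuous fun p : ℝ × ℝ => w p.1 p.2 :=
    (hW.continuousOn.comp_continuous hflow' fun p => hmem' _ _).add
      ((((hT'c.comp continuous_fst).mul continuous_snd).sub ha).smul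
        (hV.continuousOn.comp_continuous hflow' fun p => hmem' _ _))
  have hfc : Continuous fun p : ℝ × ℝ => f (φ (T p.1 * p.2) (c p.1)) :=
    hf.continuousOn.comp_continuous hflow' fun p => hmem' _ _
  set g' : ℝ → ℝ → ℝ := fun s u => deriv T s * f (φ (T s * u) (c s)) +
    T s * fderiv ℝ f (φ (T s * u) (c s)) (w s u) with hg'
  have hg'c : Continuous (uncurry g') :=
    ((hT'c.comp continuous_fst).mul hfc).add ((hT.continuous.comp continuous_fst).mul
      ((hf'.comp_continuous hflow' fun p => hmem' _ _).clm_apply hwc))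
  have hg : ∀ s u, HasDerivAt (fun s => T s * f (φ (T s * u) (c s))) (g' s u) s := fun s u =>
    (hTd s).mul ((hfd _ (hmem' s (T s * u))).comp_hasDerivAt s
      (hasDerivAt_flow_along_curve hΩ hV hW hμ hbracket hφ hmem h0 hode (hc s) (hcode s)
        ((hTd s).mul_const u)))
  have hmain : HasDerivAt (fun s => ∫ u in (0 : ℝ)..1, T s * f (φ (T s * u) (c s)))
      (∫ u in (0 : ℝ)..1, g' s u) s := hasDerivAt_intervalIntegral_of_continuous
    (fun s => continuous_const.mul (hfc.comp (Continuous.prodMk_right s))) hg'c hg s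
  have hrescale : ∀ s, ∫ u in (0 : ℝ)..1, T s * f (φ (T s * u) (c s)) =
      ∫ t in (0 : ℝ)..T s, f (φ t (c s)) := fun s => by
    rw [integral_const_mul, mul_integral_comp_mul_left (f := fun t => f (φ t (c s)))]
    simp
  rw [funext hrescale] at hmain
  refine hmain.congr_deriv ?_
  have hμs := continuous_comp_flow hμ hmem hode (hc s)
  have hh : Continuous fun t =>
      f (φ t (c s)) * μ (φ t (c s)) + fderiv ℝ f (φ t (c s)) (W (φ t (c s))) :=
    ((continuous_comp_flow hf.continuousOn hmem hode (hc s)).mul hμs).add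
      ((continuous_comp_flow hf' hmem hode (hc s)).clm_apply
        (continuous_comp_flow hW.continuousOn hmem hode (hc s)))
  have hmul : ∀ u, HasDerivAt (fun u => T s * u) (T s) u := fun u => by
    simpa using (hasDerivAt_id u).const_mul (T s)
  have hprim : ∀ u, HasDerivAt (fun u =>
      (deriv T s * u - ∫ t in (0 : ℝ)..(T s * u), μ (φ t (c s))) * f (φ (T s * u) (c s)) +
        ∫ t in (0 : ℝ)..(T s * u),
          (f (φ t (c s)) * μ (φ t (c s)) + fderiv ℝ f (φ t (c s)) (W (φ t (c s)))))
      (g' s u) u := fun u => by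
    have h1 := (hμs.integral_hasStrictDerivAt 0 (T s * u)).hasDerivAt.comp u (hmul u)
    have h2 := (hh.integral_hasStrictDerivAt 0 (T s * u)).hasDerivAt.comp u (hmul u)
    have h3 := (((hfd _ (hmem' s (T s * u))).comp_hasDerivAt _
      (hode (T s * u) _ (hc s))).comp u (hmul u))
    refine (((((hasDerivAt_id u).const_mul (deriv T s)).sub h1).mul h3).add h2).congr_deriv ?_
    simp only [hg', hw, map_add, map_smul, smul_eq_mul, id, comp_apply, Pi.sub_apply]
    ring
  rw [integral_eq_sub_of_hasDerivAt (fun u _ => hprim u)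
    ((hg'c.comp (Continuous.prodMk_right s)).intervalIntegrable 0 1)]
  have hperiod := (hasDerivAt_period hΩ hV hW hμ hbracket hφ hmem h0 hode (hc s) (hcode s)
    (hne _ (hc s)) (hTd s).differentiableAt hper).deriv
  simp [hperiod]

end Curve

end Flow

/-- recursive formula for the `n`-th derivative of the period
function: with `μ₁ = μ`, `μ_{j+1} = μ_j·μ + ∂_W μ_j`, one has
`∂_W^{(n)} T(s) = ∫₀^{T(s)} μ_n(φ_V(t, z(s))) dt`. -/
theorem period_nth_derivative_recursive
    (Ω : Set (ℝ × ℝ)) (hΩ : IsOpen Ω)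
    (V W : ℝ × ℝ → ℝ × ℝ) (μ : ℝ × ℝ → ℝ)
    (hV : ContDiffOn ℝ (⊤ : ℕ∞) V Ω) (hW : ContDiffOn ℝ (⊤ : ℕ∞) W Ω)
    (hμ : ContDiffOn ℝ (⊤ : ℕ∞) μ Ω)
    (hind : ∀ z ∈ Ω, LinearIndependent ℝ ![V z, W z])
    (hbracket : ∀ z ∈ Ω,
      fderiv ℝ W z (V z) - fderiv ℝ V z (W z) = μ z • V z)
    (μseq : ℕ → ℝ × ℝ → ℝ)
    (hμ1 : ∀ z ∈ Ω, μseq 1 z = μ z)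
    (hμrec : ∀ j : ℕ, 1 ≤ j → ∀ z ∈ Ω,
      μseq (j + 1) z = μseq j z * μ z + fderiv ℝ (μseq j) z (W z))
    (φV : ℝ → ℝ × ℝ → ℝ × ℝ)
    (hφmem : ∀ t : ℝ, ∀ z ∈ Ω, φV t z ∈ Ω)
    (hφsmooth : ContDiffOn ℝ (⊤ : ℕ∞)
      (fun p : ℝ × (ℝ × ℝ) => φV p.1 p.2) (Set.univ ×ˢ Ω))
    (hφ0 : ∀ z ∈ Ω, φV 0 z = z)
    (hφode : ∀ t : ℝ, ∀ z ∈ Ω, HasDerivAt (fun τ => φV τ z) (V (φV t z)) t)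
    (z : ℝ → ℝ × ℝ) (hz : ∀ s, z s ∈ Ω)
    (hzode : ∀ s, HasDerivAt z (W (z s)) s)
    (T : ℝ → ℝ) (hT : ContDiff ℝ (⊤ : ℕ∞) T) (hTpos : ∀ s, 0 < T s)
    (hper : ∀ s, φV (T s) (z s) = z s) :
    ∀ n : ℕ, 1 ≤ n → ∀ s,
      iteratedDeriv n T s = ∫ t in (0:ℝ)..(T s), μseq n (φV t (z s)) := by
  have hμs : ∀ n : ℕ, 1 ≤ n → ContDiffOn ℝ (⊤ : ℕ∞) (μseq n) Ω := by
    intro n hn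
    induction n, hn using Nat.le_induction with
    | base => exact hμ.congr hμ1
    | succ j hj ih =>
      exact ((ih.mul hμ).add ((ih.fderiv_of_isOpen hΩ le_rfl).clm_apply hW)).congr (hμrec j hj)
  have hV1 : ContDiffOn ℝ 1 V Ω := hV.of_le (mod_cast le_top)
  have hW1 : ContDiffOn ℝ 1 W Ω := hW.of_le (mod_cast le_top)
  have hφ2 : ContDiffOn ℝ 2 (Function.uncurry φV) (Set.univ ×ˢ Ω) :=
    hφsmooth.of_le (WithTop.coe_le_coe.2 le_top)
  have hne : ∀ z ∈ Ω, V z ≠ 0 := fun z hz => (hind z hz).ne_zero 0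
  have hT1 : ContDiff ℝ 1 T := hT.of_le (mod_cast le_top)
  intro n hn
  induction n, hn using Nat.le_induction with
  | base =>
    intro s
    rw [iteratedDeriv_one, (hasDerivAt_period hΩ hV1 hW1 hμ.continuousOn hbracket hφ2 hφmem hφ0
      hφode (hz s) (hzode s) (hne _ (hz s)) (hT1.differentiable one_ne_zero s) hper).deriv]
    exact intervalIntegral.integral_congr fun t _ => (hμ1 _ (hφmem t _ (hz s))).symm
  | succ j hj ih =>
    intro s
    rw [iteratedDeriv_succ, funext ih, (hasDerivAt_integral_orbit hΩ hV1 hW1 hμ.continuousOn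
      ((hμs j hj).of_le (mod_cast le_top)) hbracket hφ2 hφmem hφ0 hφode hz hzode hne hT1
      hper s).deriv]
    exact intervalIntegral.integral_congr fun t _ => (hμrec j hj _ (hφmem t _ (hz s))).symm
end

section
/- Let G and F be C³ real functions on open intervals, (x,y) a point with G'(x) ≠ 0 and F'(y) ≠ 0, and α, β ∈ ℝ with α + β ≥ 3. Suppose G satisfies condition (C_α) at x, i.e. 2G(x)²G''(x)² + G(x)G'(x)²G''(x) − G(x)²G'(x)G'''(x) ≥ α·G'(x)⁴, and F satisfies condition (C_β) at y, i.e. 2F(y)²F''(y)² + F(y)F'(y)²F''(y) − F(y)²F'(y)F'''(y) ≥ β·F'(y)⁴. Then μ_{s2}(x,y) = μ_s(x,y)² + ∂_{W_s}μ_s(x,y) ≥ 0, where μ_s = (2G/G')' + (2F/F')' − 2 and W_s = (2G/G', 2F/F'). -/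
/-- `Γ = 2G/G'`. -/
noncomputable def Gam (G : ℝ → ℝ) : ℝ → ℝ := fun u => 2 * G u / deriv G u

/-- `μ_s(x,y) = Γ'(x) + Φ'(y) − 2` with `Γ = 2G/G'`, `Φ = 2F/F'`. -/
noncomputable def mus (G F : ℝ → ℝ) (u v : ℝ) : ℝ :=
  deriv (Gam G) u + deriv (Gam F) v - 2

/-- `μ_{s2} = μ_s² + ∂_{W_s} μ_s`, where `W_s = (Γ(x), Φ(y))`. -/
noncomputable def mus2 (G F : ℝ → ℝ) (x y : ℝ) : ℝ :=
  (mus G F x y) ^ 2 + Gam G x * deriv (fun u => mus G F u y) x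
    + Gam F y * deriv (fun v => mus G F x v) y

open Topology in
/-- The first two derivatives of `Γ = 2G/G'` at a point where `G' ≠ 0`. -/
lemma hasDerivAt_deriv_Gam {G : ℝ → ℝ} {x : ℝ} (hG : ContDiffAt ℝ 3 G x)
    (hGx : deriv G x ≠ 0) :
    deriv (Gam G) x = 2 - 2 * (G x * deriv (deriv G) x / deriv G x ^ 2) ∧
      HasDerivAt (deriv (Gam G))
        (-2 * (((deriv G x * deriv (deriv G) x + G x * deriv (deriv (deriv G)) x) *
          deriv G x ^ 2 - G x * deriv (deriv G) x * (2 * deriv G x * deriv (deriv G) x)) /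
            (deriv G x ^ 2) ^ 2)) x := by
  have hG1 : ContDiffAt ℝ 2 (deriv G) x := hG.derivWithin (by norm_num)
  have hG2 : ContDiffAt ℝ 1 (deriv (deriv G)) x := hG1.derivWithin (by norm_num)
  have hev : deriv (Gam G) =ᶠ[𝓝 x]
      fun u => 2 - 2 * (G u * deriv (deriv G) u / deriv G u ^ 2) := by
    filter_upwards [hG.eventually (by simp), hG1.eventually (by simp),
      hG1.continuousAt.eventually_ne hGx] with u hu hu1 hne
    have h0 := (hu.differentiableAt (by norm_num)).hasDerivAt
    have h1 := (hu1.differentiableAt (by norm_num)).hasDerivAt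
    refine ((h0.const_mul 2).div h1 hne).deriv.trans ?_
    field_simp
  have h0 := (hG.differentiableAt (by norm_num)).hasDerivAt
  have h1 := (hG1.differentiableAt (by norm_num)).hasDerivAt
  have h2 := (hG2.differentiableAt (by norm_num)).hasDerivAt
  refine ⟨hev.eq_of_nhds, HasDerivAt.congr_of_eventuallyEq ?_ hev⟩
  have h := (((h0.mul h2).div (h1.pow 2) (pow_ne_zero 2 hGx)).const_mul 2).const_sub 2
  refine h.congr_deriv ?_
  simp

/-- Condition `(C_α)` bounds `Γ Γ''` from below, where `Γ = 2G/G'`. -/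
lemma Gam_mul_deriv_deriv_Gam_ge {G : ℝ → ℝ} {x α : ℝ} (hG : ContDiffAt ℝ 3 G x)
    (hGx : deriv G x ≠ 0)
    (hC : α * (deriv G x) ^ 4 ≤
        2 * (G x) ^ 2 * (deriv (deriv G) x) ^ 2
        + G x * (deriv G x) ^ 2 * deriv (deriv G) x
        - (G x) ^ 2 * deriv G x * deriv (deriv (deriv G)) x) :
    4 * (α - 2 * (G x * deriv (deriv G) x / deriv G x ^ 2)) ≤
      Gam G x * deriv (deriv (Gam G)) x := by
  rw [(hasDerivAt_deriv_Gam hG hGx).2.deriv, Gam]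
  have hpos : 0 < deriv G x ^ 4 := by positivity
  rw [← le_div_iff₀ hpos] at hC
  refine (mul_le_mul_of_nonneg_left (sub_le_sub_right hC _) (by norm_num)).trans_eq ?_
  field_simp
  ring


/-- if `G` satisfies condition (C_α) at `x`, `F` satisfies
condition (C_β) at `y` (`2L²L''² + LL'²L'' − L²L'L''' ≥ λL'⁴`), and
`α + β ≥ 3`, then `μ_{s2}(x,y) ≥ 0`. -/
theorem mus2_nonneg_of_condition_C_lambda
    (IG IF : Set ℝ) (hIGopen : IsOpen IG) (hIFopen : IsOpen IF)
    (hIGconn : IG.OrdConnected) (hIFconn : IF.OrdConnected)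
    (G F : ℝ → ℝ)
    (hG : ContDiffOn ℝ 3 G IG) (hF : ContDiffOn ℝ 3 F IF)
    (x y : ℝ) (hx : x ∈ IG) (hy : y ∈ IF)
    (hGx : deriv G x ≠ 0) (hFy : deriv F y ≠ 0)
    (α β : ℝ) (hαβ : 3 ≤ α + β)
    (hCα : α * (deriv G x) ^ 4 ≤
        2 * (G x) ^ 2 * (deriv (deriv G) x) ^ 2
        + G x * (deriv G x) ^ 2 * deriv (deriv G) x
        - (G x) ^ 2 * deriv G x * deriv (deriv (deriv G)) x)
    (hCβ : β * (deriv F y) ^ 4 ≤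
        2 * (F y) ^ 2 * (deriv (deriv F) y) ^ 2
        + F y * (deriv F y) ^ 2 * deriv (deriv F) y
        - (F y) ^ 2 * deriv F y * deriv (deriv (deriv F)) y) :
    0 ≤ mus2 G F x y := by
  have hGc := hG.contDiffAt (hIGopen.mem_nhds hx)
  have hFc := hF.contDiffAt (hIFopen.mem_nhds hy)
  have h1 := Gam_mul_deriv_deriv_Gam_ge hGc hGx hCα
  have h2 := Gam_mul_deriv_deriv_Gam_ge hFc hFy hCβ
  simp only [mus2, mus, deriv_sub_const, deriv_add_const, deriv_const_add]
  rw [(hasDerivAt_deriv_Gam hGc hGx).1, (hasDerivAt_deriv_Gam hFc hFy).1]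
  set p := G x * deriv (deriv G) x / deriv G x ^ 2
  set q := F y * deriv (deriv F) y / deriv F y ^ 2
  nlinarith [sq_nonneg (p + q - 2)]
end
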